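/- Effective resistance is a metric: let G=(V,E) be a finite simple connected graph with edge resistances R: E→(0,∞). Then for all vertices x, y, z: (i) Reff(x,y) = Reff(y,x); (ii) Reff(x,y) = 0 if and only if x = y; (iii) Reff(x,y) ≤ Reff(x,z) + Reff(z,y). -/

import Mathlib

open scoped BigOperators

/-- The divergence of `j` at `x`: the sum of `j x y` over the neighbors `y` of `x`. -/
noncomputable def flowDiv {V : Type*} (G : SimpleGraph V) (j : V → V → ℝ) (x : V) : ℝ :=
  ∑ᶠ y ∈ G.neighborSet x, j x y

/-- A flow from `a` to `b`: antisymmetric, supported on edges, divergence-free away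
from `a` and `b`. -/
def IsFlow {V : Type*} (G : SimpleGraph V) (a b : V) (j : V → V → ℝ) : Prop :=
  (∀ x y, j x y = - j y x) ∧
  (∀ x y, ¬ G.Adj x y → j x y = 0) ∧
  (∀ x, x ≠ a → x ≠ b → flowDiv G j x = 0)

/-- A unit flow from `a` to `b`: a flow with `div_j(a) = 1`. -/
def IsUnitFlow {V : Type*} (G : SimpleGraph V) (a b : V) (j : V → V → ℝ) : Prop :=
  IsFlow G a b j ∧ flowDiv G j a = 1

/-- The energy `(1/2) Σ_{x∼y} R({x,y}) j(x,y)²`, summed over ordered adjacent pairs. -/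
noncomputable def energy {V : Type*} (G : SimpleGraph V) (R : Sym2 V → ℝ)
    (j : V → V → ℝ) : ℝ :=
  (1 / 2) * ∑ᶠ x, ∑ᶠ y ∈ G.neighborSet x, R s(x, y) * (j x y) ^ 2

open Classical in
/-- The effective resistance: the infimum of the energies of unit flows from `a` to `b`,
with `Reff(a,a) = 0`. -/
noncomputable def Reff {V : Type*} (G : SimpleGraph V) (R : Sym2 V → ℝ) (a b : V) : ℝ :=
  if a = b then 0 else sInf {E | ∃ j, IsUnitFlow G a b j ∧ E = energy G R j}

section Helpers
open Classical

noncomputable def condW {V : Type*} (G : SimpleGraph V) (R : Sym2 V → ℝ) (x y : V) : ℝ :=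
  if G.Adj x y then (R s(x, y))⁻¹ else 0

theorem condW_symm {V : Type*} (G : SimpleGraph V) (R : Sym2 V → ℝ) (x y : V) :
    condW G R x y = condW G R y x := by
  simp only [condW, G.adj_comm x y, Sym2.eq_swap (a := x) (b := y)]

theorem condW_nonneg {V : Type*} (G : SimpleGraph V) (R : Sym2 V → ℝ)
    (hR : ∀ e ∈ G.edgeSet, 0 < R e) (x y : V) : 0 ≤ condW G R x y := by
  unfold condW
  split_ifs with h
  · exact (inv_pos.2 (hR _ h)).le
  · exact le_rfl

theorem condW_pos {V : Type*} (G : SimpleGraph V) (R : Sym2 V → ℝ)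
    (hR : ∀ e ∈ G.edgeSet, 0 < R e) {x y : V} (h : G.Adj x y) : 0 < condW G R x y := by
  unfold condW
  rw [if_pos h]
  exact inv_pos.2 (hR _ h)

theorem flowDiv_eq_sum {V : Type*} [Fintype V] (G : SimpleGraph V) (j : V → V → ℝ)
    (hj : ∀ x y, ¬ G.Adj x y → j x y = 0) (x : V) : flowDiv G j x = ∑ y, j x y := by
  unfold flowDiv
  rw [finsum_eq_sum_of_fintype]
  refine Finset.sum_congr rfl fun y _ => ?_
  rw [finsum_eq_if]
  split_ifs with h
  · rfl
  · exact (hj x y h).symm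

theorem energy_eq_sum {V : Type*} [Fintype V] (G : SimpleGraph V) (R : Sym2 V → ℝ)
    (j : V → V → ℝ) (hj : ∀ x y, ¬ G.Adj x y → j x y = 0) :
    energy G R j = (1 / 2) * ∑ x, ∑ y, R s(x, y) * (j x y) ^ 2 := by
  unfold energy
  rw [finsum_eq_sum_of_fintype]
  congr 1
  refine Finset.sum_congr rfl fun x _ => ?_
  rw [finsum_eq_sum_of_fintype]
  refine Finset.sum_congr rfl fun y _ => ?_
  rw [finsum_eq_if]
  split_ifs with h
  · rfl
  · rw [hj x y h]; ring

theorem green_id {V : Type*} [Fintype V] (k : V → V → ℝ) (hk : ∀ x y, k x y = - k y x)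
    (f : V → ℝ) : ∑ x, ∑ y, k x y * (f x - f y) = 2 * ∑ x, f x * ∑ y, k x y := by
  have h1 : ∑ x, ∑ y, k x y * f y = - ∑ x, ∑ y, k x y * f x := by
    rw [Finset.sum_comm, ← Finset.sum_neg_distrib]
    refine Finset.sum_congr rfl fun x _ => ?_
    rw [← Finset.sum_neg_distrib]
    refine Finset.sum_congr rfl fun y _ => ?_
    rw [hk y x]; ring
  have h2 : ∑ x, f x * ∑ y, k x y = ∑ x, ∑ y, k x y * f x := by
    refine Finset.sum_congr rfl fun x _ => ?_
    rw [Finset.mul_sum]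
    exact Finset.sum_congr rfl fun y _ => mul_comm _ _
  simp only [mul_sub, Finset.sum_sub_distrib]
  rw [h1, h2]; ring

theorem const_of_adj {V : Type*} (G : SimpleGraph V) (hG : G.Connected) (f : V → ℝ)
    (h : ∀ x y, G.Adj x y → f x = f y) (x y : V) : f x = f y := by
  obtain ⟨p⟩ := hG.preconnected x y
  induction p with
  | nil => rfl
  | cons hadj _ ih => exact (h _ _ hadj).trans ih

noncomputable def lapW {V : Type*} [Fintype V] (G : SimpleGraph V) (R : Sym2 V → ℝ)
    (φ : V → ℝ) (v : V) : ℝ := ∑ y, condW G R v y * (φ v - φ y)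

theorem lapW_green {V : Type*} [Fintype V] (G : SimpleGraph V) (R : Sym2 V → ℝ) (φ f : V → ℝ) :
    ∑ x, ∑ y, condW G R x y * (φ x - φ y) * (f x - f y) = 2 * ∑ x, f x * lapW G R φ x := by
  refine green_id (fun x y => condW G R x y * (φ x - φ y)) (fun x y => ?_) f
  simp only [condW_symm G R x y]; ring

theorem sum_lapW {V : Type*} [Fintype V] (G : SimpleGraph V) (R : Sym2 V → ℝ) (φ : V → ℝ) :
    ∑ x, lapW G R φ x = 0 := by
  have h := lapW_green G R φ (fun _ => 1)
  simp at h
  linarith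

/-- If the weighted Dirichlet form vanishes then the function is constant. -/
theorem const_of_form {V : Type*} [Fintype V] (G : SimpleGraph V) (hG : G.Connected)
    (R : Sym2 V → ℝ) (hR : ∀ e ∈ G.edgeSet, 0 < R e) (f : V → ℝ)
    (h : ∑ x, ∑ y, condW G R x y * (f x - f y) ^ 2 ≤ 0) (x y : V) : f x = f y := by
  have nn : ∀ x y, 0 ≤ condW G R x y * (f x - f y) ^ 2 := fun x y =>
    mul_nonneg (condW_nonneg G R hR x y) (sq_nonneg _)
  have h0 : ∑ x, ∑ y, condW G R x y * (f x - f y) ^ 2 = 0 :=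
    le_antisymm h (Finset.sum_nonneg fun x _ => Finset.sum_nonneg fun y _ => nn x y)
  refine const_of_adj G hG f (fun u v huv => ?_) x y
  rw [Finset.sum_eq_zero_iff_of_nonneg
    (fun x _ => Finset.sum_nonneg fun y _ => nn x y)] at h0
  have h1 := h0 u (Finset.mem_univ _)
  rw [Finset.sum_eq_zero_iff_of_nonneg (fun y _ => nn u y)] at h1
  have h2 := h1 v (Finset.mem_univ _)
  rcases mul_eq_zero.1 h2 with h3 | h3
  · exact absurd h3 (condW_pos G R hR huv).ne'
  · have := pow_eq_zero_iff (two_ne_zero) |>.1 h3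
    linarith

def IsPot {V : Type*} [Fintype V] (G : SimpleGraph V) (R : Sym2 V → ℝ) (a b : V)
    (φ : V → ℝ) : Prop :=
  ∀ v, lapW G R φ v = (if v = a then 1 else 0) - (if v = b then 1 else 0)

theorem IsPot.neg {V : Type*} [Fintype V] {G : SimpleGraph V} {R : Sym2 V → ℝ} {a b : V}
    {φ : V → ℝ} (h : IsPot G R a b φ) : IsPot G R b a (fun v => - φ v) := by
  intro v
  have h1 := h v
  have h2 : lapW G R (fun v => - φ v) v = - lapW G R φ v := by
    unfold lapW
    rw [← Finset.sum_neg_distrib]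
    exact Finset.sum_congr rfl fun y _ => by ring
  rw [h2, h1]; ring

theorem IsPot.add {V : Type*} [Fintype V] {G : SimpleGraph V} {R : Sym2 V → ℝ} {a b c : V}
    {φ ψ : V → ℝ} (h : IsPot G R a b φ) (h' : IsPot G R b c ψ) :
    IsPot G R a c (fun v => φ v + ψ v) := by
  intro v
  have h2 : lapW G R (fun v => φ v + ψ v) v = lapW G R φ v + lapW G R ψ v := by
    unfold lapW
    rw [← Finset.sum_add_distrib]
    exact Finset.sum_congr rfl fun y _ => by ring
  rw [h2, h v, h' v]; ring

theorem IsPot.sum_mul {V : Type*} [Fintype V] {G : SimpleGraph V} {R : Sym2 V → ℝ} {a b : V}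
    {φ : V → ℝ} (h : IsPot G R a b φ) (f : V → ℝ) :
    ∑ x, f x * lapW G R φ x = f a - f b := by
  simp only [h _, mul_sub, Finset.sum_sub_distrib, mul_ite, mul_one, mul_zero,
    Finset.sum_ite_eq', Finset.mem_univ, if_true]

theorem exists_pot {V : Type*} [Fintype V] (G : SimpleGraph V) (hG : G.Connected)
    (R : Sym2 V → ℝ) (hR : ∀ e ∈ G.edgeSet, 0 < R e) (a b : V) : ∃ φ, IsPot G R a b φ := by
  have hne : Nonempty V := ⟨a⟩
  have hcard : (Fintype.card V : ℝ) ≠ 0 := by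
    exact_mod_cast Fintype.card_ne_zero
  let T : (V → ℝ) →ₗ[ℝ] (V → ℝ) :=
    { toFun := fun φ v => lapW G R φ v + ∑ u, φ u
      map_add' := by
        intro φ ψ
        funext v
        simp only [lapW, Pi.add_apply, Finset.sum_add_distrib]
        have : ∑ y, condW G R v y * (φ v + ψ v - (φ y + ψ y))
            = ∑ y, condW G R v y * (φ v - φ y) + ∑ y, condW G R v y * (ψ v - ψ y) := by
          rw [← Finset.sum_add_distrib]
          exact Finset.sum_congr rfl fun y _ => by ring
        rw [this]; ring
      map_smul' := by
        intro r φ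
        funext v
        simp only [lapW, Pi.smul_apply, smul_eq_mul, RingHom.id_apply, mul_add, Finset.mul_sum]
        congr 1
        exact Finset.sum_congr rfl fun y _ => by ring }
  have hT : ∀ φ v, T φ v = lapW G R φ v + ∑ u, φ u := fun _ _ => rfl
  have hsum : ∀ φ, ∑ v, T φ v = Fintype.card V * ∑ u, φ u := by
    intro φ
    simp only [hT, Finset.sum_add_distrib, sum_lapW]
    simp
  have hinj : Function.Injective T := by
    rw [injective_iff_map_eq_zero]
    intro φ hφ
    have h0 : ∑ u, φ u = 0 := by
      have := hsum φ
      rw [hφ] at this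
      simp only [Pi.zero_apply, Finset.sum_const_zero] at this
      rcases mul_eq_zero.1 this.symm with h | h
      · exact absurd h hcard
      · exact h
    have hl : ∀ v, lapW G R φ v = 0 := by
      intro v
      have := hT φ v
      rw [hφ, h0] at this
      simp at this
      exact this.symm
    have hc := const_of_form G hG R hR φ (by
      have := lapW_green G R φ φ
      simp only [hl, mul_zero, Finset.sum_const_zero] at this
      rw [← this]
      refine le_of_eq (Finset.sum_congr rfl fun x _ => Finset.sum_congr rfl fun y _ => by ring))
    funext v
    have : ∑ u, φ u = Fintype.card V * φ v := by
      rw [Finset.sum_congr rfl fun u _ => hc u v]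
      simp
    rw [h0] at this
    rcases mul_eq_zero.1 this.symm with h | h
    · exact absurd h hcard
    · exact h
  obtain ⟨φ, hφ⟩ := (LinearMap.injective_iff_surjective.1 hinj)
    (fun v => (if v = a then (1:ℝ) else 0) - (if v = b then 1 else 0))
  refine ⟨φ, fun v => ?_⟩
  have h0 : ∑ u, φ u = 0 := by
    have := hsum φ
    rw [hφ] at this
    simp only [Finset.sum_sub_distrib, Finset.sum_ite_eq', Finset.mem_univ, if_true,
      sub_self] at this
    rcases mul_eq_zero.1 this.symm with h | h
    · exact absurd h hcard
    · exact h
  have := hT φ v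
  rw [hφ, h0, add_zero] at this
  exact this.symm

theorem IsPot.le_left {V : Type*} [Fintype V] {G : SimpleGraph V} (hG : G.Connected)
    {R : Sym2 V → ℝ} (hR : ∀ e ∈ G.edgeSet, 0 < R e) {a b : V}
    {φ : V → ℝ} (h : IsPot G R a b φ) (v : V) : φ v ≤ φ a := by
  let f : V → ℝ := fun u => max (φ u - φ a) 0
  have hfa : f a = 0 := by simp [f]
  have hfb : 0 ≤ f b := le_max_right _ _
  have h1 := lapW_green G R φ f
  rw [h.sum_mul f, hfa] at h1
  have hle : ∑ x, ∑ y, condW G R x y * (f x - f y) ^ 2 ≤ 0 := by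
    calc _ ≤ ∑ x, ∑ y, condW G R x y * (φ x - φ y) * (f x - f y) := by
          refine Finset.sum_le_sum fun x _ => Finset.sum_le_sum fun y _ => ?_
          rw [mul_assoc]
          refine mul_le_mul_of_nonneg_left ?_ (condW_nonneg G R hR x y)
          simp only [f]
          rcases max_cases (φ x - φ a) 0 with ⟨e1, e2⟩ | ⟨e1, e2⟩ <;>
          rcases max_cases (φ y - φ a) 0 with ⟨e3, e4⟩ | ⟨e3, e4⟩ <;>
          rw [e1, e3] <;> nlinarith
      _ ≤ 0 := by rw [h1]; linarith
  have := const_of_form G hG R hR f hle v a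
  rw [hfa] at this
  have h3 : φ v - φ a ≤ f v := le_max_left _ _
  linarith

theorem IsPot.right_le {V : Type*} [Fintype V] {G : SimpleGraph V} (hG : G.Connected)
    {R : Sym2 V → ℝ} (hR : ∀ e ∈ G.edgeSet, 0 < R e) {a b : V}
    {φ : V → ℝ} (h : IsPot G R a b φ) (v : V) : φ b ≤ φ v := by
  have := h.neg.le_left hG hR v
  simpa using this

theorem IsPot.reff {V : Type*} [Fintype V] {G : SimpleGraph V}
    {R : Sym2 V → ℝ} (hR : ∀ e ∈ G.edgeSet, 0 < R e) {a b : V}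
    {φ : V → ℝ} (h : IsPot G R a b φ) : Reff G R a b = φ a - φ b := by
  unfold Reff
  split_ifs with hab
  · rw [hab]; ring
  have hgr : ∑ x, ∑ y, condW G R x y * (φ x - φ y) ^ 2 = 2 * (φ a - φ b) := by
    rw [← h.sum_mul φ, ← lapW_green]
    exact Finset.sum_congr rfl fun x _ => Finset.sum_congr rfl fun y _ => by ring
  refine IsLeast.csInf_eq ⟨⟨fun x y => condW G R x y * (φ x - φ y), ?_, ?_⟩, ?_⟩
  · have hs : ∀ x y, ¬ G.Adj x y → condW G R x y * (φ x - φ y) = 0 := by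
      intro x y hxy
      simp [condW, hxy]
    refine ⟨⟨?_, hs, ?_⟩, ?_⟩
    · intro x y
      simp only [condW_symm G R x y]; ring
    · intro x hxa hxb
      rw [flowDiv_eq_sum G _ hs]
      have := h x
      simpa [lapW, hxa, hxb] using this
    · rw [flowDiv_eq_sum G _ hs]
      have := h a
      simpa [lapW, hab] using this
  · rw [energy_eq_sum]
    · have : ∑ x, ∑ y, R s(x, y) * (condW G R x y * (φ x - φ y)) ^ 2
          = ∑ x, ∑ y, condW G R x y * (φ x - φ y) ^ 2 := by
        refine Finset.sum_congr rfl fun x _ => Finset.sum_congr rfl fun y _ => ?_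
        unfold condW
        split_ifs with hxy
        · have := (hR s(x, y) hxy).ne'
          field_simp
        · ring
      rw [this, hgr]; ring
    · intro x y hxy
      simp [condW, hxy]
  · rintro E ⟨k, ⟨⟨hanti, hs, hdiv⟩, hone⟩, rfl⟩
    rw [energy_eq_sum G R k hs]
    rw [flowDiv_eq_sum G k hs] at hone
    have hdiv' : ∀ x, x ≠ a → x ≠ b → ∑ y, k x y = 0 := fun x h1 h2 => by
      rw [← flowDiv_eq_sum G k hs]; exact hdiv x h1 h2
    have hpair : ∀ f : V → ℝ, ∑ x, f x * ∑ y, k x y = f a + f b * ∑ y, k b y := by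
      intro f
      rw [Finset.sum_eq_add a b hab, hone, mul_one]
      · intro c _ hc
        rw [hdiv' c hc.1 hc.2, mul_zero]
      · simp
      · simp
    have hb : ∑ y, k b y = -1 := by
      have h1 := hpair (fun _ => 1)
      have h2 := green_id k hanti (fun _ => 1)
      rw [h1] at h2
      simp at h2
      linarith
    have hk := green_id k hanti φ
    rw [hpair, hb] at hk
    have hle : ∑ x, ∑ y, (2 * (k x y * (φ x - φ y)) - condW G R x y * (φ x - φ y) ^ 2)
        ≤ ∑ x, ∑ y, R s(x, y) * (k x y) ^ 2 := by
      refine Finset.sum_le_sum fun x _ => Finset.sum_le_sum fun y _ => ?_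
      unfold condW
      split_ifs with hxy
      · have hp : 0 < R s(x, y) := hR _ hxy
        have : R s(x, y) * (k x y) ^ 2 - (2 * (k x y * (φ x - φ y))
            - (R s(x, y))⁻¹ * (φ x - φ y) ^ 2)
            = (R s(x, y))⁻¹ * (R s(x, y) * k x y - (φ x - φ y)) ^ 2 := by
          field_simp
          ring
        have h2 : 0 ≤ (R s(x, y))⁻¹ * (R s(x, y) * k x y - (φ x - φ y)) ^ 2 := by positivity
        linarith
      · rw [hs x y hxy]; simp
    simp only [Finset.sum_sub_distrib, ← Finset.mul_sum] at hle
    rw [hk, hgr] at hle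
    linarith

end Helpers

theorem effective_resistance_is_metric {V : Type*} [Fintype V]
    (G : SimpleGraph V) (hG : G.Connected)
    (R : Sym2 V → ℝ) (hR : ∀ e ∈ G.edgeSet, 0 < R e) :
    ∀ x y z : V,
      Reff G R x y = Reff G R y x ∧
      (Reff G R x y = 0 ↔ x = y) ∧
      Reff G R x y ≤ Reff G R x z + Reff G R z y := by
  intro x y z
  obtain ⟨φ, hφ⟩ := exists_pot G hG R hR x z
  obtain ⟨ψ, hψ⟩ := exists_pot G hG R hR z y
  have hs := hφ.add hψ
  refine ⟨?_, ⟨?_, ?_⟩, ?_⟩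
  · rw [hs.reff hR, hs.neg.reff hR]; ring
  · intro h0
    by_contra hxy
    rw [hs.reff hR] at h0
    have hc : ∀ v, φ v + ψ v = φ x + ψ x := fun v =>
      le_antisymm (hs.le_left hG hR v) (by
        have := hs.right_le hG hR v
        linarith)
    have h1 := hs x
    simp [lapW, hc, hxy] at h1
  · rintro rfl
    simp [Reff]
  · rw [hs.reff hR, hφ.reff hR, hψ.reff hR]
    have h1 := hφ.right_le hG hR y
    have h2 := hψ.le_left hG hR x
    linarith
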